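/- Let n ≥ 1, let Ω ⊆ ℝⁿ be a measurable set, let 0 < r < T/2, and let u : ℝ × ℝⁿ → ℝ be jointly measurable such that for almost every x ∈ Ω the map t ↦ u(t,x) is differentiable on (0,T) with derivative ∂ₜu(t,x), and suppose that both u and ∂ₜu belong to L²((0,T) × Ω). Then for every τ with 0 < τ ≤ r one has ∫_r^{T-r} ∫_Ω (u(t+τ,x) − u(t,x))² dx dt ≤ 2 τ ‖∂ₜu‖_{L²((0,T)×Ω)} ‖u‖_{L²((0,T)×Ω)}. -/

import Mathlib

open MeasureTheory Set

lemma tte_oneDim (τ : ℝ) (hτ : 0 < τ) (h g : ℝ → ℝ) (hg : Measurable g)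
    (hd : ∀ s ∈ Icc (0 : ℝ) τ, HasDerivAt h (g s) s) :
    ENNReal.ofReal ((h τ - h 0) ^ 2)
      ≤ ENNReal.ofReal τ * ∫⁻ s in Ioc (0 : ℝ) τ, ENNReal.ofReal ((g s) ^ 2) := by
  by_cases hfin : ∫⁻ s in Ioc (0 : ℝ) τ, ENNReal.ofReal ((g s) ^ 2) = ⊤
  · rw [hfin, ENNReal.mul_top (by simpa using hτ)]
    exact le_top
  have hint2 : IntegrableOn (fun s => (g s) ^ 2) (Ioc 0 τ) := by
    refine ⟨(hg.pow_const 2).aestronglyMeasurable, ?_⟩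
    rw [hasFiniteIntegral_iff_ofReal (Filter.Eventually.of_forall fun s => sq_nonneg _)]
    exact lt_top_iff_ne_top.2 hfin
  have hint : IntegrableOn g (Ioc 0 τ) := by
    have h1 : IntegrableOn (fun s => 1 + (g s) ^ 2) (Ioc 0 τ) :=
      (integrableOn_const (by simp)).add hint2
    refine Integrable.mono' h1 hg.aestronglyMeasurable (Filter.Eventually.of_forall fun s => ?_)
    rw [Real.norm_eq_abs, abs_le]
    constructor <;> nlinarith [sq_nonneg (g s - 1), sq_nonneg (g s + 1)]
  have hD : ∫ s in Ioc 0 τ, g s = h τ - h 0 := by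
    rw [← intervalIntegral.integral_of_le hτ.le]
    refine intervalIntegral.integral_eq_sub_of_hasDerivAt (fun s hs => hd s ?_) ?_
    · rwa [uIcc_of_le hτ.le] at hs
    · exact (intervalIntegrable_iff_integrableOn_Ioc_of_le hτ.le).2 hint
  rw [← ofReal_integral_eq_lintegral_ofReal hint2
    (Filter.Eventually.of_forall fun s => sq_nonneg _), ← ENNReal.ofReal_mul hτ.le]
  apply ENNReal.ofReal_le_ofReal
  set D := h τ - h 0
  have hnn : 0 ≤ ∫ s in Ioc 0 τ, (τ * g s - D) ^ 2 := integral_nonneg fun s => sq_nonneg _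
  have hexp : ∫ s in Ioc 0 τ, (τ * g s - D) ^ 2
      = τ ^ 2 * (∫ s in Ioc 0 τ, (g s) ^ 2) - (2 * τ * D) * D + τ * D ^ 2 := by
    have e : ∀ s, (τ * g s - D) ^ 2 = τ ^ 2 * (g s) ^ 2 - (2 * τ * D) * g s + D ^ 2 := by
      intro s; ring
    simp_rw [e]
    have hsub : IntegrableOn (fun s => τ ^ 2 * (g s) ^ 2 - (2 * τ * D) * g s) (Ioc 0 τ) :=
      (hint2.const_mul _).sub (hint.const_mul _)
    rw [integral_add hsub (integrableOn_const (by simp)),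
      integral_sub (hint2.const_mul _) (hint.const_mul _), integral_const_mul,
      integral_const_mul, hD]
    simp [hτ.le]
  rw [hexp] at hnn
  have : 0 ≤ τ * (τ * (∫ s in Ioc 0 τ, (g s) ^ 2) - D ^ 2) := by nlinarith
  have := nonneg_of_mul_nonneg_right this hτ
  linarith

lemma tte_translate {n : ℕ} (T r s : ℝ) (hr : 0 < r)
    (Ω : Set (EuclideanSpace ℝ (Fin n))) (hΩ : MeasurableSet Ω)
    (f : ℝ × EuclideanSpace ℝ (Fin n) → ENNReal) (hs : 0 ≤ s) (hsr : s ≤ r) :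
    ∫⁻ p in Ioo r (T - r) ×ˢ Ω, f (p.1 + s, p.2) ≤ ∫⁻ p in Ioo (0 : ℝ) T ×ˢ Ω, f p := by
  have : (volume : Measure (ℝ × EuclideanSpace ℝ (Fin n))).IsAddRightInvariant := by
    rw [Measure.volume_eq_prod]; infer_instance
  rw [← lintegral_indicator (measurableSet_Ioo.prod hΩ),
    ← lintegral_indicator (measurableSet_Ioo.prod hΩ),
    ← lintegral_add_right_eq_self ((Ioo (0 : ℝ) T ×ˢ Ω).indicator f) ((s, 0) : ℝ × EuclideanSpace ℝ (Fin n))]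
  apply lintegral_mono
  intro p
  beta_reduce
  by_cases hp : p ∈ Ioo r (T - r) ×ˢ Ω
  · have hq : p + (s, 0) ∈ Ioo (0 : ℝ) T ×ˢ Ω := by
      obtain ⟨⟨h1, h2⟩, h3⟩ := hp
      refine ⟨⟨?_, ?_⟩, ?_⟩
      · simp; linarith
      · simp; linarith
      · simpa using h3
    rw [indicator_of_mem hp, indicator_of_mem hq]
    have : p + (s, 0) = (p.1 + s, p.2) := by ext <;> simp
    rw [this]
  · rw [indicator_of_notMem hp]
    exact zero_le


/-- Time-translate estimate: if `u` and its time derivative `∂ₜu` are in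
`L²((0,T) × Ω)`, then for `0 < τ ≤ r < T/2`,
`∫_r^{T-r} ∫_Ω (u(t+τ,x) − u(t,x))² ≤ 2τ ‖∂ₜu‖_{L²} ‖u‖_{L²}`. -/
theorem time_translate_estimate
    (n : ℕ) (hn : 1 ≤ n) (T r : ℝ) (hr : 0 < r) (hrT : r < T / 2)
    (Ω : Set (EuclideanSpace ℝ (Fin n))) (hΩ : MeasurableSet Ω)
    (u ut : ℝ → EuclideanSpace ℝ (Fin n) → ℝ)
    (hu_meas : Measurable (Function.uncurry u))
    (hut_meas : Measurable (Function.uncurry ut))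
    (hderiv : ∀ᵐ x ∂(volume : Measure (EuclideanSpace ℝ (Fin n))), x ∈ Ω →
      ∀ t ∈ Set.Ioo (0 : ℝ) T, HasDerivAt (fun s => u s x) (ut t x) t)
    (hu2 : IntegrableOn (fun p : ℝ × EuclideanSpace ℝ (Fin n) => (u p.1 p.2) ^ 2)
      (Set.Ioo (0 : ℝ) T ×ˢ Ω))
    (hut2 : IntegrableOn (fun p : ℝ × EuclideanSpace ℝ (Fin n) => (ut p.1 p.2) ^ 2)
      (Set.Ioo (0 : ℝ) T ×ˢ Ω))
    (τ : ℝ) (hτ : 0 < τ) (hτr : τ ≤ r) :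
    ∫⁻ p in Set.Ioo r (T - r) ×ˢ Ω,
        ENNReal.ofReal ((u (p.1 + τ) p.2 - u p.1 p.2) ^ 2)
      ≤ ENNReal.ofReal (2 * τ *
          Real.sqrt (∫ p in Set.Ioo (0 : ℝ) T ×ˢ Ω, (ut p.1 p.2) ^ 2) *
          Real.sqrt (∫ p in Set.Ioo (0 : ℝ) T ×ˢ Ω, (u p.1 p.2) ^ 2)) := by
  set S := Ioo (0 : ℝ) T ×ˢ Ω with hS
  set S' := Ioo r (T - r) ×ˢ Ω with hS'
  have hS'm : MeasurableSet S' := measurableSet_Ioo.prod hΩ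
  set V := ∫ p in S, (ut p.1 p.2) ^ 2
  set U := ∫ p in S, (u p.1 p.2) ^ 2
  have hV0 : 0 ≤ V := integral_nonneg fun p => sq_nonneg _
  have hU0 : 0 ≤ U := integral_nonneg fun p => sq_nonneg _
  have hV : ∫⁻ p in S, ENNReal.ofReal ((ut p.1 p.2) ^ 2) = ENNReal.ofReal V :=
    (ofReal_integral_eq_lintegral_ofReal hut2
      (Filter.Eventually.of_forall fun p => sq_nonneg _)).symm
  have hU : ∫⁻ p in S, ENNReal.ofReal ((u p.1 p.2) ^ 2) = ENNReal.ofReal U :=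
    (ofReal_integral_eq_lintegral_ofReal hu2
      (Filter.Eventually.of_forall fun p => sq_nonneg _)).symm
  set A := ∫⁻ p in S', ENNReal.ofReal ((u (p.1 + τ) p.2 - u p.1 p.2) ^ 2)
  have hA2 : A ≤ ENNReal.ofReal (4 * U) := by
    have t1 := tte_translate T r τ hr Ω hΩ (fun p => ENNReal.ofReal ((u p.1 p.2) ^ 2)) hτ.le hτr
    have t0 := tte_translate T r 0 hr Ω hΩ (fun p => ENNReal.ofReal ((u p.1 p.2) ^ 2)) le_rfl hr.le
    simp only [add_zero] at t0
    rw [← hS, ← hS', hU] at t0 t1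
    have hm : Measurable fun p : ℝ × EuclideanSpace ℝ (Fin n) =>
        ENNReal.ofReal ((u (p.1 + τ) p.2) ^ 2) := by
      have : Measurable fun p : ℝ × EuclideanSpace ℝ (Fin n) => u (p.1 + τ) p.2 :=
        hu_meas.comp ((measurable_fst.add_const τ).prodMk measurable_snd)
      exact (this.pow_const 2).ennreal_ofReal
    calc A ≤ ∫⁻ p in S', 2 * (ENNReal.ofReal ((u (p.1 + τ) p.2) ^ 2)
              + ENNReal.ofReal ((u p.1 p.2) ^ 2)) := by
          apply lintegral_mono
          intro p
          have h2 : (2 : ENNReal) = ENNReal.ofReal 2 := by simp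
          simp only
          rw [← ENNReal.ofReal_add (sq_nonneg _) (sq_nonneg _), h2,
            ← ENNReal.ofReal_mul (by norm_num)]
          apply ENNReal.ofReal_le_ofReal
          nlinarith [sq_nonneg (u (p.1 + τ) p.2 + u p.1 p.2)]
      _ = 2 * ((∫⁻ p in S', ENNReal.ofReal ((u (p.1 + τ) p.2) ^ 2))
            + ∫⁻ p in S', ENNReal.ofReal ((u p.1 p.2) ^ 2)) := by
          rw [lintegral_const_mul' _ _ (by simp), lintegral_add_left hm]
      _ ≤ 2 * (ENNReal.ofReal U + ENNReal.ofReal U) := by gcongr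
      _ = ENNReal.ofReal (4 * U) := by
          have h2 : (2 : ENNReal) = ENNReal.ofReal 2 := by simp
          rw [← ENNReal.ofReal_add hU0 hU0, h2, ← ENNReal.ofReal_mul (by norm_num)]
          congr 1; ring
  have hA1 : A ≤ ENNReal.ofReal (τ ^ 2 * V) := by
    have hae : ∀ᵐ p ∂(volume : Measure (ℝ × EuclideanSpace ℝ (Fin n))), p.2 ∈ Ω →
        ∀ t ∈ Set.Ioo (0 : ℝ) T, HasDerivAt (fun s => u s p.2) (ut t p.2) t :=
      Measure.quasiMeasurePreserving_snd.ae hderiv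
    have hm : Measurable fun q : (ℝ × EuclideanSpace ℝ (Fin n)) × ℝ =>
        ENNReal.ofReal ((ut (q.1.1 + q.2) q.1.2) ^ 2) := by
      have : Measurable fun q : (ℝ × EuclideanSpace ℝ (Fin n)) × ℝ => ut (q.1.1 + q.2) q.1.2 :=
        hut_meas.comp (((measurable_fst.comp measurable_fst).add measurable_snd).prodMk
          (measurable_snd.comp measurable_fst))
      exact (this.pow_const 2).ennreal_ofReal
    calc A ≤ ∫⁻ p in S', ENNReal.ofReal τ *
              ∫⁻ s in Ioc (0 : ℝ) τ, ENNReal.ofReal ((ut (p.1 + s) p.2) ^ 2) := by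
          apply lintegral_mono_ae
          filter_upwards [ae_restrict_of_ae hae, ae_restrict_mem hS'm] with p hp hpS
          obtain ⟨⟨h1, h2⟩, h3⟩ := hpS
          have key := tte_oneDim τ hτ (fun s => u (p.1 + s) p.2) (fun s => ut (p.1 + s) p.2)
            (hut_meas.comp ((measurable_id.const_add p.1).prodMk measurable_const)) (by
              intro s hs
              have := hp h3 (p.1 + s) ⟨by linarith [hs.1], by linarith [hs.2]⟩
              exact this.comp_const_add p.1 s)
          simpa using key
      _ = ENNReal.ofReal τ * ∫⁻ s in Ioc (0 : ℝ) τ, ∫⁻ p in S',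
              ENNReal.ofReal ((ut (p.1 + s) p.2) ^ 2) := by
          rw [lintegral_const_mul' _ _ (by simp), lintegral_lintegral_swap hm.aemeasurable]
      _ ≤ ENNReal.ofReal τ * ∫⁻ s in Ioc (0 : ℝ) τ, ENNReal.ofReal V := by
          gcongr 1
          apply setLIntegral_mono measurable_const
          intro s hs
          rw [← hV]
          exact tte_translate T r s hr Ω hΩ (fun p => ENNReal.ofReal ((ut p.1 p.2) ^ 2))
            hs.1.le (hs.2.trans hτr)
      _ = ENNReal.ofReal (τ ^ 2 * V) := by
          rw [setLIntegral_const, Real.volume_Ioc, sub_zero, ← ENNReal.ofReal_mul hV0,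
            ← ENNReal.ofReal_mul hτ.le]
          congr 1; ring
  have hAfin : A ≠ ⊤ := ne_top_of_le_ne_top ENNReal.ofReal_ne_top hA1
  rw [← ENNReal.ofReal_toReal hAfin] at hA1 hA2 ⊢
  rw [ENNReal.ofReal_le_ofReal_iff (by positivity)] at hA1 hA2
  apply ENNReal.ofReal_le_ofReal
  have ha : 0 ≤ A.toReal := ENNReal.toReal_nonneg
  refine abs_le_of_sq_le_sq' ?_ (by positivity) |>.2
  have : (2 * τ * √V * √U) ^ 2 = (τ ^ 2 * V) * (4 * U) := by
    rw [mul_pow, mul_pow, Real.sq_sqrt hV0, Real.sq_sqrt hU0]; ring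
  rw [this, sq]
  exact mul_le_mul hA1 hA2 ha (by positivity)
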